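/- Define rotation systems of K₅ (complete graph on Fin 5): a function assigning to each vertex a cyclic ordering of its 4 neighbors; there are 6⁵ = 7776 rotation systems. Darts are ordered pairs of adjacent vertices (20 darts) and the face permutation sends (x,y) to (y, ρ_y(x)); faces are its orbits. Let the group Aut(K₅) × C₂ act on rotation systems, where Aut(K₅) = Perm (Fin 5) acts by relabeling (ρ ↦ ρ' with ρ'_{φ(y)}(φ(x)) = φ(ρ_y(x))) and the nontrivial element of C₂ acts by reversal (inverting every vertex rotation). Then: (1) the number of orbits of rotation systems with exactly 3 faces under Aut(K₅) × C₂ is 31; and (2) the number of orbits of rotation systems with exactly 3 faces under Aut(K₅) alone is 45. -/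

import Mathlib

/-- A rotation system of `K₅` assigns to each vertex a permutation of `Fin 5`. -/
abbrev K5RotSys := Fin 5 → Equiv.Perm (Fin 5)

/-- Each rotation fixes its vertex and is a single 4-cycle on the 4 neighbors. -/
def IsRotSysK5 (ρ : K5RotSys) : Prop :=
  ∀ y : Fin 5, (ρ y).IsCycle ∧ ρ y y = y ∧ (ρ y).support.card = 4

/-- The face permutation on darts: `Φ (x, y) = (y, ρ_y x)`. -/
def facePermK5 (ρ : K5RotSys) : Fin 5 × Fin 5 → Fin 5 × Fin 5 :=
  fun d => (d.2, ρ d.2 d.1)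

/-- Two darts lie on the same face. -/
def SameFace (ρ : K5RotSys) (d d' : Fin 5 × Fin 5) : Prop :=
  ∃ k : ℕ, (facePermK5 ρ)^[k] d = d'

/-- The face permutation has exactly `n` orbits on the 20 darts. -/
def HasFaces (ρ : K5RotSys) (n : ℕ) : Prop :=
  ∃ D : Fin n → Fin 5 × Fin 5,
    (∀ i, (D i).1 ≠ (D i).2) ∧
    (∀ i j, i ≠ j → ¬ SameFace ρ (D i) (D j)) ∧
    ∀ d : Fin 5 × Fin 5, d.1 ≠ d.2 → ∃ i, SameFace ρ (D i) d

/-- Equivalence under `Aut(K₅) × C₂`: relabelling by a permutation `φ` of the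
vertices, optionally composed with reversal of all rotations. -/
def EquivFullK5 (ρ ρ' : K5RotSys) : Prop :=
  ∃ φ : Equiv.Perm (Fin 5), ∃ r : Bool,
    ∀ y, ρ' (φ y) = φ * (if r then (ρ y)⁻¹ else ρ y) * φ⁻¹

/-- Equivalence under `Aut(K₅)` alone: relabelling by a permutation of the
vertices. -/
def EquivAutK5 (ρ ρ' : K5RotSys) : Prop :=
  ∃ φ : Equiv.Perm (Fin 5), ∀ y, ρ' (φ y) = φ * ρ y * φ⁻¹

/-- The octal digit of `T` in position `i`. -/
def octDigit (T i : ℕ) : ℕ := T / 8 ^ i % 8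

/-- The value `f n`, arranged so that the kernel evaluates `n` first. -/
def evalAt (f : ℕ → Bool) : ℕ → Bool
  | 0 => f 0
  | n + 1 => f (n + 1)

/-- Sum of the first five values. -/
def sumFive (f : ℕ → ℕ) : ℕ := f 0 + f 1 + f 2 + f 3 + f 4

/-- The number whose octal digits are the values of a permutation. -/
def permCode (φ : Equiv.Perm (Fin 5)) : ℕ := ∑ x : Fin 5, (φ x : ℕ) * 8 ^ (x : ℕ)

/-- The octal digit of `rotCode ρ` in position `5 * y + x` is `ρ y x`. -/
def rotCode (ρ : K5RotSys) : ℕ :=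
  ∑ y : Fin 5, ∑ x : Fin 5, (ρ y x : ℕ) * 8 ^ (5 * (y : ℕ) + x)

/-- Relabelling of codes. -/
def transportCode (P T : ℕ) : ℕ :=
  sumFive fun y => sumFive fun x =>
    octDigit P (octDigit T (5 * y + x)) * 8 ^ (5 * octDigit P y + octDigit P x)

/-- Reversal of codes. -/
def reverseCode (T : ℕ) : ℕ :=
  sumFive fun y => sumFive fun x => x * 8 ^ (5 * y + octDigit T (5 * y + x))

/-- The face permutation in terms of codes, the dart `(x, y)` being numbered `5 * x + y`. -/
def nextDart (T d : ℕ) : ℕ := 5 * (d % 5) + octDigit T (5 * (d % 5) + d / 5)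

/-- Whether `d ≤ e` for the first `n` darts `e` on the face of `c`, from `c` onwards. -/
def leOnFace (T d : ℕ) : ℕ → ℕ → Bool
  | 0, _ => true
  | n + 1, c => Nat.ble d c && evalAt (leOnFace T d n) (nextDart T c)

/-- The number of darts that have the least number on their face. -/
def faceCount (T : ℕ) : ℕ :=
  ((List.range 25).filter fun d => !(Nat.beq (d % 6) 0) && leOnFace T d 25 d).length

/-- The six cyclic orders of the neighbours of the vertex `0`. -/
def baseRot : Fin 6 → Equiv.Perm (Fin 5) :=
  ![[1, 2, 3, 4].formPerm, [1, 2, 4, 3].formPerm, [1, 3, 2, 4].formPerm,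
    [1, 3, 4, 2].formPerm, [1, 4, 2, 3].formPerm, [1, 4, 3, 2].formPerm]

/-- The six cyclic orders of the neighbours of the vertex `y`. -/
def vertexRot (y : Fin 5) (k : Fin 6) : Equiv.Perm (Fin 5) :=
  Equiv.addRight y * baseRot k * (Equiv.addRight y)⁻¹

/-- The permutations of the vertices, as pairs of the preimage of `0` and the code. -/
def permCodes : List (ℕ × ℕ) :=
  (permsOfList (List.finRange 5)).map fun φ => ((φ⁻¹ 0 : Fin 5), permCode φ)

/-- Whether the permutation with code `P`, sending `y` to `0`, relabels the rotation system with
code `T` to one whose rotation at `0` is `baseRot 0`. -/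
def isNormalizing (T : ℕ) (P : ℕ × ℕ) : Bool :=
  (List.range 5).all fun x =>
    Nat.beq (octDigit P.2 (octDigit T (5 * P.1 + x)))
      (octDigit (permCode (baseRot 0)) (octDigit P.2 x))

/-- The rotation at vertex `y`, as a summand of `rotCode`. -/
def vertexCode (y : Fin 5) (k : Fin 6) : ℕ :=
  ∑ x : Fin 5, (vertexRot y k x : ℕ) * 8 ^ (5 * (y : ℕ) + x)

/-- Representatives of the isomorphism classes of embeddings of `K₅` in the double torus. The first
17 are isomorphic to their mirror images, and the last 14 are isomorphic to the mirror images
of the 14 preceding them. -/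
def repIndex : Fin 45 → Fin 5 → Fin 6 :=
  ![![0, 0, 0, 0, 0], ![0, 0, 0, 0, 2], ![0, 0, 0, 2, 2], ![0, 0, 2, 1, 2], ![0, 1, 3, 0, 0],
    ![0, 1, 3, 0, 2], ![0, 2, 0, 0, 2], ![0, 2, 2, 0, 2], ![0, 2, 2, 2, 2], ![0, 2, 3, 1, 2],
    ![0, 3, 1, 0, 2], ![0, 4, 0, 1, 2], ![0, 4, 0, 2, 2], ![0, 4, 1, 1, 2], ![0, 4, 4, 0, 2],
    ![0, 4, 5, 1, 2], ![0, 5, 2, 1, 2],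
    ![0, 0, 2, 1, 0], ![0, 0, 4, 0, 2], ![0, 1, 0, 2, 4],
    ![0, 1, 3, 1, 2], ![0, 1, 4, 0, 2], ![0, 1, 4, 1, 2], ![0, 1, 5, 0, 2], ![0, 2, 1, 0, 2],
    ![0, 2, 2, 1, 2], ![0, 2, 4, 1, 2], ![0, 3, 0, 1, 2], ![0, 3, 3, 1, 2], ![0, 3, 5, 1, 2],
    ![0, 5, 0, 1, 2],
    ![0, 1, 2, 1, 2], ![0, 4, 0, 0, 2], ![0, 3, 5, 2, 2], ![0, 2, 2, 1, 0],
    ![0, 4, 3, 0, 2], ![0, 4, 4, 1, 2], ![0, 5, 3, 0, 2], ![0, 3, 1, 1, 2], ![0, 4, 1, 2, 2],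
    ![0, 3, 4, 1, 2], ![0, 4, 0, 1, 0], ![0, 5, 0, 0, 2], ![0, 5, 1, 0, 2], ![0, 5, 3, 1, 2]]

/-- The code of the rotation system with the given rotations. -/
def indexCode (k : Fin 5 → Fin 6) : ℕ := ∑ y, vertexCode y (k y)

/-- The codes of the representatives. -/
def repCodes : List ℕ := (List.finRange 45).map fun i => indexCode (repIndex i)

theorem evalAt_eq (f : ℕ → Bool) (n : ℕ) : evalAt f n = f n := by
  cases n <;> rfl

theorem sumFive_eq_sum (f : ℕ → ℕ) : sumFive f = ∑ i : Fin 5, f i := by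
  simp [sumFive, Fin.sum_univ_five]

theorem octDigit_sum_range (f : ℕ → ℕ) (hf : ∀ i, f i < 8) {n j : ℕ} (h : j < n) :
    octDigit (∑ i ∈ Finset.range n, f i * 8 ^ i) j = f j := by
  unfold octDigit
  induction n generalizing f j with
  | zero => omega
  | succ n ih =>
    have hs : ∑ i ∈ Finset.range (n + 1), f i * 8 ^ i =
        8 * (∑ i ∈ Finset.range n, f (i + 1) * 8 ^ i) + f 0 := by
      rw [Finset.sum_range_succ', Finset.mul_sum]
      congr 1
      · exact Finset.sum_congr rfl fun i _ => by ring
      · simp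
    have h0 := hf 0
    rw [hs]
    cases j with
    | zero => rw [pow_zero, Nat.div_one]; omega
    | succ j =>
      rw [pow_succ', ← Nat.div_div_eq_div_mul,
        show ∀ m, (8 * m + f 0) / 8 = m by omega]
      exact ih (fun i => f (i + 1)) (fun i => hf _) (by omega)

theorem octDigit_permCode (φ : Equiv.Perm (Fin 5)) (x : Fin 5) :
    octDigit (permCode φ) x = φ x := by
  have h := octDigit_sum_range (fun i => (φ (Fin.ofNat 5 i) : ℕ)) (fun i => by omega) x.isLt
  rw [Finset.sum_range] at h
  simpa [permCode] using h

theorem octDigit_rotCode (ρ : K5RotSys) (y x : Fin 5) :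
    octDigit (rotCode ρ) (5 * y + x) = ρ y x := by
  have h := octDigit_sum_range (fun i => (ρ (Fin.ofNat 5 (i / 5)) (Fin.ofNat 5 i) : ℕ))
    (fun i => by omega) (show 5 * (y : ℕ) + x < 5 * 5 by omega)
  have hs : rotCode ρ = ∑ i ∈ Finset.range (5 * 5),
      (ρ (Fin.ofNat 5 (i / 5)) (Fin.ofNat 5 i) : ℕ) * 8 ^ i := by
    rw [Finset.sum_range, ← finProdFinEquiv.sum_comp, Fintype.sum_prod_type]
    refine Finset.sum_congr rfl fun y _ => Finset.sum_congr rfl fun x _ => ?_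
    have h₁ : Fin.ofNat 5 ((x + 5 * y : ℕ) / 5) = y := by ext; simp; omega
    have h₂ : Fin.ofNat 5 (x + 5 * y : ℕ) = x := by ext; simp
    simp only [finProdFinEquiv_apply_val, h₁, h₂, add_comm (5 * (y : ℕ))]
  rw [hs, h]
  have h₁ : Fin.ofNat 5 ((5 * y + x : ℕ) / 5) = y := by ext; simp; omega
  have h₂ : Fin.ofNat 5 (5 * y + x : ℕ) = x := by ext; simp
  rw [h₁, h₂]

theorem rotCode_injective : Function.Injective rotCode := by
  intro ρ ρ' h
  ext y x
  rw [← octDigit_rotCode, h, octDigit_rotCode]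

/-- The rotation system obtained by relabelling the vertices. -/
def transport (φ : Equiv.Perm (Fin 5)) (ρ : K5RotSys) : K5RotSys :=
  fun y => φ * ρ (φ⁻¹ y) * φ⁻¹

@[simp]
theorem transport_apply_apply (φ : Equiv.Perm (Fin 5)) (ρ : K5RotSys) (y x : Fin 5) :
    transport φ ρ (φ y) (φ x) = φ (ρ y x) := by
  simp [transport]

theorem transport_mul (φ ψ : Equiv.Perm (Fin 5)) (ρ : K5RotSys) :
    transport (φ * ψ) ρ = transport φ (transport ψ ρ) := by
  funext y
  simp [transport, mul_assoc]

theorem transport_inv_transport (φ : Equiv.Perm (Fin 5)) (ρ : K5RotSys) :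
    transport φ⁻¹ (transport φ ρ) = ρ := by
  funext y
  simp [transport, mul_assoc]

theorem equivAutK5_iff {ρ ρ' : K5RotSys} : EquivAutK5 ρ ρ' ↔ ∃ φ, transport φ ρ = ρ' := by
  refine exists_congr fun φ => ⟨fun h => ?_, ?_⟩
  · funext y
    simpa [transport] using (h (φ⁻¹ y)).symm
  · rintro rfl y
    simp [transport]

theorem EquivAutK5.symm {ρ ρ' : K5RotSys} (h : EquivAutK5 ρ ρ') : EquivAutK5 ρ' ρ := by
  rw [equivAutK5_iff] at *
  obtain ⟨φ, rfl⟩ := h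
  exact ⟨φ⁻¹, transport_inv_transport φ ρ⟩

theorem EquivAutK5.trans {ρ ρ' ρ'' : K5RotSys} (h : EquivAutK5 ρ ρ') (h' : EquivAutK5 ρ' ρ'') :
    EquivAutK5 ρ ρ'' := by
  rw [equivAutK5_iff] at *
  obtain ⟨φ, rfl⟩ := h
  obtain ⟨ψ, rfl⟩ := h'
  exact ⟨ψ * φ, transport_mul ψ φ ρ⟩

theorem equivFullK5_iff {ρ ρ' : K5RotSys} :
    EquivFullK5 ρ ρ' ↔ EquivAutK5 ρ ρ' ∨ EquivAutK5 (fun y => (ρ y)⁻¹) ρ' := by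
  simp only [EquivFullK5, EquivAutK5, Bool.exists_bool, if_true, Bool.false_eq_true, if_false,
    exists_or]

theorem rotCode_transport (φ : Equiv.Perm (Fin 5)) (ρ : K5RotSys) :
    rotCode (transport φ ρ) = transportCode (permCode φ) (rotCode ρ) := by
  simp only [transportCode, sumFive_eq_sum, octDigit_rotCode, octDigit_permCode]
  rw [rotCode, ← Equiv.sum_comp φ]
  refine Finset.sum_congr rfl fun y _ => ?_
  rw [← Equiv.sum_comp φ]
  simp only [transport_apply_apply]

theorem rotCode_inv (ρ : K5RotSys) :
    rotCode (fun y => (ρ y)⁻¹) = reverseCode (rotCode ρ) := by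
  simp only [reverseCode, sumFive_eq_sum, octDigit_rotCode]
  refine Finset.sum_congr rfl fun y _ => ?_
  rw [← Equiv.sum_comp (ρ y)]
  simp

theorem mem_permCodes {P : ℕ × ℕ} :
    P ∈ permCodes ↔ ∃ φ : Equiv.Perm (Fin 5), (((φ⁻¹ 0 : Fin 5) : ℕ), permCode φ) = P := by
  simp [permCodes, mem_permsOfList_iff]

theorem isNormalizing_iff (φ : Equiv.Perm (Fin 5)) (ρ : K5RotSys) :
    isNormalizing (rotCode ρ) ((φ⁻¹ 0 : Fin 5), permCode φ) = true ↔
      transport φ ρ 0 = baseRot 0 := by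
  have h : isNormalizing (rotCode ρ) ((φ⁻¹ 0 : Fin 5), permCode φ) = true ↔
      ∀ x : Fin 5, octDigit (permCode φ) (octDigit (rotCode ρ) (5 * (φ⁻¹ 0 : Fin 5) + x)) =
        octDigit (permCode (baseRot 0)) (octDigit (permCode φ) x) := by
    simp only [isNormalizing, List.all_eq_true, List.mem_range, Nat.beq_eq, Fin.forall_iff]
  simp only [h, octDigit_rotCode, octDigit_permCode, Fin.val_inj, Equiv.ext_iff]
  refine (forall_congr' fun x => ?_).trans φ.forall_congr_right
  simp [transport]

/-! ### Faces -/

theorem facePermK5_bijective (ρ : K5RotSys) : Function.Bijective (facePermK5 ρ) := by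
  refine Finite.injective_iff_bijective.1 fun d d' h => ?_
  obtain ⟨h₁, h₂⟩ := Prod.ext_iff.1 h
  simp only [facePermK5] at h₁ h₂
  rw [h₁] at h₂
  exact Prod.ext ((ρ _).injective h₂) h₁

theorem sameFace_iff_sameCycle {ρ : K5RotSys} {d d' : Fin 5 × Fin 5} :
    SameFace ρ d d' ↔ Equiv.Perm.SameCycle (Equiv.ofBijective _ (facePermK5_bijective ρ)) d d' := by
  have h : ∀ k : ℕ,
      ((Equiv.ofBijective _ (facePermK5_bijective ρ) : Equiv.Perm (Fin 5 × Fin 5)) ^ k) d =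
      (facePermK5 ρ)^[k] d := fun k => by
    rw [← Equiv.Perm.iterate_eq_pow]; rfl
  constructor
  · rintro ⟨k, rfl⟩
    exact ⟨k, by rw [zpow_natCast, h]⟩
  · intro hs
    obtain ⟨k, -, hk⟩ := hs.exists_pow_eq'
    exact ⟨k, by rw [← h, hk]⟩

theorem SameFace.symm {ρ : K5RotSys} {d d' : Fin 5 × Fin 5} (h : SameFace ρ d d') :
    SameFace ρ d' d :=
  sameFace_iff_sameCycle.2 (sameFace_iff_sameCycle.1 h).symm

theorem SameFace.trans {ρ : K5RotSys} {d d' d'' : Fin 5 × Fin 5} (h : SameFace ρ d d')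
    (h' : SameFace ρ d' d'') : SameFace ρ d d'' :=
  sameFace_iff_sameCycle.2 ((sameFace_iff_sameCycle.1 h).trans (sameFace_iff_sameCycle.1 h'))

theorem SameFace.exists_lt {ρ : K5RotSys} {d d' : Fin 5 × Fin 5} (h : SameFace ρ d d') :
    ∃ k < 25, (facePermK5 ρ)^[k] d = d' := by
  obtain ⟨k, rfl⟩ := h
  have hp : d ∈ Function.periodicPts (facePermK5 ρ) :=
    (facePermK5_bijective ρ).injective.mem_periodicPts d
  refine ⟨k % Function.minimalPeriod (facePermK5 ρ) d, ?_, Function.iterate_mod_minimalPeriod_eq⟩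
  refine (Nat.mod_lt _ (Function.minimalPeriod_pos_of_mem_periodicPts hp)).trans_le ?_
  exact Function.minimalPeriod_le_card

theorem IsRotSysK5.ne_of_sameFace {ρ : K5RotSys} (hρ : IsRotSysK5 ρ) {d d' : Fin 5 × Fin 5}
    (h : SameFace ρ d d') (hd : d.1 ≠ d.2) : d'.1 ≠ d'.2 := by
  obtain ⟨k, rfl⟩ := h
  induction k with
  | zero => exact hd
  | succ k ih =>
    rw [Function.iterate_succ_apply']
    intro he
    refine ih ((ρ ((facePermK5 ρ)^[k] d).2).injective ?_)
    rw [(hρ _).2.1]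
    exact he.symm

open Classical in
/-- The darts that have the least number on their face. -/
noncomputable def leastDarts (ρ : K5RotSys) : Finset (Fin 5 × Fin 5) :=
  {d | d.1 ≠ d.2 ∧ ∀ d', SameFace ρ d d' → finProdFinEquiv d ≤ finProdFinEquiv d'}

theorem mem_leastDarts {ρ : K5RotSys} {d : Fin 5 × Fin 5} : d ∈ leastDarts ρ ↔
    d.1 ≠ d.2 ∧ ∀ d', SameFace ρ d d' → finProdFinEquiv d ≤ finProdFinEquiv d' := by
  simp [leastDarts]

theorem eq_of_mem_leastDarts {ρ : K5RotSys} {d d' : Fin 5 × Fin 5} (hd : d ∈ leastDarts ρ)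
    (hd' : d' ∈ leastDarts ρ) (h : SameFace ρ d d') : d = d' :=
  finProdFinEquiv.injective
    (le_antisymm ((mem_leastDarts.1 hd).2 _ h) ((mem_leastDarts.1 hd').2 _ h.symm))

theorem exists_mem_leastDarts {ρ : K5RotSys} (hρ : IsRotSysK5 ρ) {d : Fin 5 × Fin 5}
    (hd : d.1 ≠ d.2) : ∃ d' ∈ leastDarts ρ, SameFace ρ d d' := by
  obtain ⟨d', h, hmin⟩ := Set.exists_min_image {d' | SameFace ρ d d'}
    (fun d' => finProdFinEquiv d') (Set.toFinite _) ⟨d, 0, rfl⟩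
  exact ⟨d', mem_leastDarts.2 ⟨hρ.ne_of_sameFace h hd, fun d'' h' => hmin _ (h.trans h')⟩, h⟩

theorem hasFaces_iff_card_leastDarts {ρ : K5RotSys} (hρ : IsRotSysK5 ρ) (n : ℕ) :
    HasFaces ρ n ↔ (leastDarts ρ).card = n := by
  constructor
  · rintro ⟨D, hD, hdisj, hex⟩
    choose g hg hDg using fun i => exists_mem_leastDarts hρ (hD i)
    rw [← Finset.card_fin n]
    refine (Finset.card_bij (fun i _ => g i) (fun i _ => hg i) (fun i _ j _ h => ?_)
      fun d hd => ?_).symm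
    · by_contra hij
      exact hdisj i j hij ((hDg i).trans (h ▸ (hDg j).symm))
    · obtain ⟨i, hi⟩ := hex d (mem_leastDarts.1 hd).1
      exact ⟨i, Finset.mem_univ i, eq_of_mem_leastDarts (hg i) hd ((hDg i).symm.trans hi)⟩
  · intro h
    let e := (leastDarts ρ).equivFinOfCardEq h
    refine ⟨fun i => e.symm i, fun i => (mem_leastDarts.1 (e.symm i).2).1, fun i j hij hs => ?_,
      fun d hd => ?_⟩
    · exact hij (e.symm.injective (Subtype.ext
        (eq_of_mem_leastDarts (e.symm i).2 (e.symm j).2 hs)))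
    · obtain ⟨d', hd', hs⟩ := exists_mem_leastDarts hρ hd
      exact ⟨e ⟨d', hd'⟩, by simpa using hs.symm⟩

theorem nextDart_rotCode (ρ : K5RotSys) (d : Fin 5 × Fin 5) :
    nextDart (rotCode ρ) (finProdFinEquiv d) = finProdFinEquiv (facePermK5 ρ d) := by
  obtain ⟨x, y⟩ := d
  have h₁ : ((y : ℕ) + 5 * x) % 5 = y := by omega
  have h₂ : ((y : ℕ) + 5 * x) / 5 = x := by omega
  simp only [nextDart, finProdFinEquiv_apply_val, h₁, h₂, octDigit_rotCode, facePermK5]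
  omega

theorem leOnFace_rotCode (ρ : K5RotSys) (m n : ℕ) (d : Fin 5 × Fin 5) :
    leOnFace (rotCode ρ) m n (finProdFinEquiv d) = true ↔
      ∀ k < n, m ≤ finProdFinEquiv ((facePermK5 ρ)^[k] d) := by
  induction n generalizing d with
  | zero => simp [leOnFace]
  | succ n ih =>
    rw [leOnFace, Bool.and_eq_true, evalAt_eq, nextDart_rotCode, ih, Nat.ble_eq,
      Nat.forall_lt_succ_left]
    rfl

theorem mem_leastDarts_iff_leOnFace {ρ : K5RotSys} {d : Fin 5 × Fin 5} :
    d ∈ leastDarts ρ ↔ (!(Nat.beq ((finProdFinEquiv d : ℕ) % 6) 0) &&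
      leOnFace (rotCode ρ) (finProdFinEquiv d) 25 (finProdFinEquiv d)) = true := by
  rw [mem_leastDarts, Bool.and_eq_true, leOnFace_rotCode]
  refine and_congr ?_ ⟨fun h k _ => h _ ⟨k, rfl⟩, ?_⟩
  · revert d
    decide
  · intro h d' hd'
    obtain ⟨k, hk, rfl⟩ := hd'.exists_lt
    exact h k hk

theorem card_leastDarts (ρ : K5RotSys) : (leastDarts ρ).card = faceCount (rotCode ρ) := by
  rw [faceCount, ← List.toFinset_card_of_nodup (List.nodup_range.filter _), List.toFinset_filter,
    List.toFinset_range]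
  refine Finset.card_bij (fun d _ => (finProdFinEquiv d : ℕ)) (fun d hd => ?_)
    (fun d _ d' _ h => finProdFinEquiv.injective (Fin.ext h)) fun n hn => ?_
  · exact Finset.mem_filter.2
      ⟨Finset.mem_range.2 (finProdFinEquiv d).isLt, mem_leastDarts_iff_leOnFace.1 hd⟩
  · obtain ⟨hn, h⟩ := Finset.mem_filter.1 hn
    obtain ⟨d, hd⟩ := (finProdFinEquiv (m := 5) (n := 5)).surjective ⟨n, Finset.mem_range.1 hn⟩
    obtain rfl : (finProdFinEquiv d : ℕ) = n := congrArg Fin.val hd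
    exact ⟨d, mem_leastDarts_iff_leOnFace.2 h, rfl⟩

theorem hasFaces_iff {ρ : K5RotSys} (hρ : IsRotSysK5 ρ) (n : ℕ) :
    HasFaces ρ n ↔ faceCount (rotCode ρ) = n := by
  rw [hasFaces_iff_card_leastDarts hρ, card_leastDarts]

theorem facePermK5_transport_semiconj (φ : Equiv.Perm (Fin 5)) (ρ : K5RotSys) :
    Function.Semiconj (Prod.map φ φ) (facePermK5 ρ) (facePermK5 (transport φ ρ)) := by
  rintro ⟨x, y⟩
  simp [facePermK5]

theorem sameFace_transport (φ : Equiv.Perm (Fin 5)) (ρ : K5RotSys) (d d' : Fin 5 × Fin 5) :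
    SameFace (transport φ ρ) (Prod.map φ φ d) (Prod.map φ φ d') ↔ SameFace ρ d d' := by
  refine exists_congr fun k => ?_
  rw [← ((facePermK5_transport_semiconj φ ρ).iterate_right k).eq]
  exact (φ.injective.prodMap φ.injective).eq_iff

theorem HasFaces.transport {ρ : K5RotSys} {n : ℕ} (h : HasFaces ρ n) (φ : Equiv.Perm (Fin 5)) :
    HasFaces (transport φ ρ) n := by
  obtain ⟨D, hD, hdisj, hex⟩ := h
  refine ⟨fun i => Prod.map φ φ (D i), fun i => φ.injective.ne (hD i), fun i j hij => ?_,
    fun d hd => ?_⟩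
  · rw [sameFace_transport]
    exact hdisj i j hij
  · obtain ⟨d, rfl⟩ := (φ.surjective.prodMap φ.surjective) d
    obtain ⟨i, hi⟩ := hex d (fun h => hd (congrArg φ h))
    exact ⟨i, (sameFace_transport φ ρ _ _).2 hi⟩

/-! ### Enumeration of rotation systems -/

theorem IsRotSysK5.transport {ρ : K5RotSys} (hρ : IsRotSysK5 ρ) (φ : Equiv.Perm (Fin 5)) :
    IsRotSysK5 (transport φ ρ) := by
  intro y
  obtain ⟨h₁, h₂, h₃⟩ := hρ (φ⁻¹ y)
  refine ⟨h₁.conj, ?_, ?_⟩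
  · simp only [_root_.transport, Equiv.Perm.mul_apply, h₂]
    exact φ.apply_symm_apply y
  · rw [_root_.transport, Equiv.Perm.card_support_conj, h₃]

theorem baseRot_spec (k : Fin 6) :
    (baseRot k).IsCycle ∧ baseRot k 0 = 0 ∧ (baseRot k).support.card = 4 := by
  unfold Equiv.Perm.IsCycle
  revert k
  decide +kernel

theorem exists_baseRot_eq :
    ∀ σ : Equiv.Perm (Fin 5), σ 0 = 0 → σ.support.card = 4 → σ.IsCycle → ∃ k, baseRot k = σ := by
  unfold Equiv.Perm.IsCycle
  decide +kernel

theorem isRotSysK5_iff {ρ : K5RotSys} :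
    IsRotSysK5 ρ ↔ ∃ k : Fin 5 → Fin 6, ρ = fun y => vertexRot y (k y) := by
  constructor
  · intro hρ
    have h : ∀ y, ∃ k, vertexRot y k = ρ y := fun y => by
      obtain ⟨h₁, h₂, h₃⟩ := hρ y
      obtain ⟨k, hk⟩ := exists_baseRot_eq ((Equiv.addRight y)⁻¹ * ρ y * (Equiv.addRight y))
        (by simp [h₂]) (by
          simpa only [h₃, inv_inv] using
            Equiv.Perm.card_support_conj (σ := (Equiv.addRight y)⁻¹) (τ := ρ y))
        (by simpa only [inv_inv] using h₁.conj (g := (Equiv.addRight y)⁻¹))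
      exact ⟨k, by rw [vertexRot, hk]; group⟩
    choose k hk using h
    exact ⟨k, funext fun y => (hk y).symm⟩
  · rintro ⟨k, rfl⟩ y
    obtain ⟨h₁, h₂, h₃⟩ := baseRot_spec (k y)
    refine ⟨h₁.conj, ?_, ?_⟩
    · simp [vertexRot, h₂]
    · simpa only [vertexRot, Equiv.Perm.card_support_conj] using h₃

theorem baseRot_conj (k : Fin 6) :
    ∃ φ : Equiv.Perm (Fin 5), φ⁻¹ 0 = 0 ∧ φ * baseRot k * φ⁻¹ = baseRot 0 := by
  revert k
  decide +kernel

theorem vertexRot_zero_injective : Function.Injective (vertexRot 0) := by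
  intro k l
  revert k l
  decide +kernel

theorem vertexRot_zero (k : Fin 6) : vertexRot 0 k = baseRot k := by
  ext; simp [vertexRot]

theorem IsRotSysK5.exists_transport {ρ : K5RotSys} (hρ : IsRotSysK5 ρ) :
    ∃ φ, _root_.transport φ ρ 0 = baseRot 0 := by
  obtain ⟨k, rfl⟩ := isRotSysK5_iff.1 hρ
  obtain ⟨φ, h₀, h⟩ := baseRot_conj (k 0)
  exact ⟨φ, by simp only [_root_.transport, h₀, vertexRot_zero, h]⟩

/-! ### Representatives -/

theorem faceCount_repIndex : ∀ i, faceCount (indexCode (repIndex i)) = 3 := by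
  decide +kernel

theorem indexCode_repIndex_le : ∀ i, ∀ P ∈ permCodes,
    isNormalizing (indexCode (repIndex i)) P = true →
      indexCode (repIndex i) ≤ transportCode P.2 (indexCode (repIndex i)) := by
  have h : ∀ i, (permCodes.all fun P => !isNormalizing (indexCode (repIndex i)) P ||
      Nat.ble (indexCode (repIndex i)) (transportCode P.2 (indexCode (repIndex i)))) = true := by
    decide +kernel
  intro i P hP hn
  simpa [hn] using List.all_eq_true.1 (h i) P hP

theorem indexCode_repIndex_injective : Function.Injective fun i => indexCode (repIndex i) := by
  have h : repCodes.Nodup := by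
    have h : repCodes.Pairwise (· ≠ ·) := by decide +kernel
    exact h
  exact List.nodup_ofFn.1 (List.ofFn_eq_map ▸ h)

theorem exists_transportCode_lt (k : Fin 5 → Fin 6) (hk : k 0 = 0)
    (hf : faceCount (indexCode k) = 3) : indexCode k ∈ repCodes ∨
      ∃ P ∈ permCodes, isNormalizing (indexCode k) P = true ∧
        transportCode P.2 (indexCode k) < indexCode k := by
  have h : ∀ b c d e : Fin 6, evalAt (fun T => !Nat.beq (faceCount T) 3 ||
      (permCodes.any fun P => isNormalizing T P && Nat.blt (transportCode P.2 T) T) ||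
      repCodes.any (Nat.beq T)) (indexCode ![0, b, c, d, e]) = true := by
    decide +kernel
  have hk' : ![0, k 1, k 2, k 3, k 4] = k := by
    funext y; fin_cases y <;> simp [hk]
  have hT := h (k 1) (k 2) (k 3) (k 4)
  rw [evalAt_eq, hk'] at hT
  simp only [hf, Bool.or_eq_true, List.any_eq_true, Bool.and_eq_true, Nat.beq_eq, Nat.blt_eq,
    Bool.not_eq_true', exists_eq_right', Nat.beq_refl] at hT
  simpa [or_comm] using hT

/-- The index of the mirror image. -/
def mirrorIndex (i : Fin 45) : Fin 45 :=
  if i.1 < 17 then i else if i.1 < 31 then i + 14 else i - 14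

theorem exists_transportCode_reverseCode : ∀ i, ∃ P ∈ permCodes,
    transportCode P.2 (reverseCode (indexCode (repIndex i))) =
      indexCode (repIndex (mirrorIndex i)) := by
  have h : ∀ i, (permCodes.any fun P =>
      isNormalizing (reverseCode (indexCode (repIndex i))) P &&
        Nat.beq (transportCode P.2 (reverseCode (indexCode (repIndex i))))
          (indexCode (repIndex (mirrorIndex i)))) = true := by
    decide +kernel
  intro i
  obtain ⟨P, hP, h⟩ := List.any_eq_true.1 (h i)
  exact ⟨P, hP, Nat.eq_of_beq_eq_true (Bool.and_eq_true_iff.1 h).2⟩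

/-- The representatives, as rotation systems. -/
def repSys (i : Fin 45) : K5RotSys := fun y => vertexRot y (repIndex i y)

theorem rotCode_repSys (i : Fin 45) : rotCode (repSys i) = indexCode (repIndex i) := rfl

theorem isRotSysK5_repSys (i : Fin 45) : IsRotSysK5 (repSys i) :=
  isRotSysK5_iff.2 ⟨repIndex i, rfl⟩

theorem hasFaces_repSys (i : Fin 45) : HasFaces (repSys i) 3 :=
  (hasFaces_iff (isRotSysK5_repSys i) 3).2 (faceCount_repIndex i)

theorem repSys_apply_zero (i : Fin 45) : repSys i 0 = baseRot 0 := by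
  have h : ∀ i, repIndex i 0 = 0 := by decide
  rw [repSys, h, vertexRot_zero]

theorem exists_equivAutK5_repSys_of_normalized {ρ : K5RotSys} (hρ : IsRotSysK5 ρ)
    (h₀ : ρ 0 = baseRot 0) (hf : HasFaces ρ 3) : ∃ i, EquivAutK5 (repSys i) ρ := by
  induction hN : rotCode ρ using Nat.strong_induction_on generalizing ρ with
  | _ N ih =>
    subst hN
    obtain ⟨k, hk⟩ := isRotSysK5_iff.1 hρ
    have hc : rotCode ρ = indexCode k := by rw [hk]; rfl
    have hk₀ : k 0 = 0 := vertexRot_zero_injective <| by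
      rw [vertexRot_zero 0, ← h₀, hk]
    rw [hasFaces_iff hρ, hc] at hf
    obtain h | ⟨P, hP, hn, hlt⟩ := exists_transportCode_lt k hk₀ hf
    · obtain ⟨i, -, hi⟩ := List.mem_map.1 h
      refine ⟨i, equivAutK5_iff.2 ⟨1, rotCode_injective ?_⟩⟩
      rw [hc, ← hi]
      rfl
    · obtain ⟨φ, rfl⟩ := mem_permCodes.1 hP
      rw [← hc] at hn hlt hf
      rw [← rotCode_transport] at hlt
      obtain ⟨i, hi⟩ := ih _ hlt (hρ.transport φ) ((isNormalizing_iff φ ρ).1 hn)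
        (((hasFaces_iff hρ 3).2 hf).transport φ) rfl
      exact ⟨i, hi.trans (EquivAutK5.symm (equivAutK5_iff.2 ⟨φ, rfl⟩))⟩

theorem exists_equivAutK5_repSys {ρ : K5RotSys} (hρ : IsRotSysK5 ρ) (hf : HasFaces ρ 3) :
    ∃ i, EquivAutK5 (repSys i) ρ := by
  obtain ⟨φ, h₀⟩ := hρ.exists_transport
  obtain ⟨i, hi⟩ := exists_equivAutK5_repSys_of_normalized (hρ.transport φ) h₀ (hf.transport φ)
  exact ⟨i, hi.trans (EquivAutK5.symm (equivAutK5_iff.2 ⟨φ, rfl⟩))⟩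

theorem rotCode_repSys_le {i : Fin 45} {ρ : K5RotSys} (h₀ : ρ 0 = baseRot 0)
    (h : EquivAutK5 (repSys i) ρ) : rotCode (repSys i) ≤ rotCode ρ := by
  obtain ⟨φ, hφ⟩ := equivAutK5_iff.1 h
  have hn : isNormalizing (indexCode (repIndex i)) ((φ⁻¹ 0 : Fin 5), permCode φ) = true := by
    rw [← rotCode_repSys, isNormalizing_iff, hφ, h₀]
  rw [← hφ, rotCode_transport, rotCode_repSys]
  exact indexCode_repIndex_le i (_, permCode φ) (mem_permCodes.2 ⟨φ, rfl⟩) hn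

theorem repSys_equivAutK5_iff {i j : Fin 45} : EquivAutK5 (repSys i) (repSys j) ↔ i = j := by
  constructor
  · intro h
    exact indexCode_repIndex_injective (le_antisymm
      (rotCode_repSys_le (repSys_apply_zero j) h) (rotCode_repSys_le (repSys_apply_zero i) h.symm))
  · rintro rfl
    exact equivAutK5_iff.2 ⟨1, rfl⟩

theorem existsUnique_equivAutK5_repSys {ρ : K5RotSys} (hρ : IsRotSysK5 ρ) (hf : HasFaces ρ 3) :
    ∃! i, EquivAutK5 (repSys i) ρ := by
  obtain ⟨i, hi⟩ := exists_equivAutK5_repSys hρ hf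
  exact ⟨i, hi, fun j hj => repSys_equivAutK5_iff.1 (hj.trans hi.symm)⟩

theorem equivAutK5_inv_repSys (i : Fin 45) :
    EquivAutK5 (fun y => (repSys i y)⁻¹) (repSys (mirrorIndex i)) := by
  obtain ⟨P, hP, h⟩ := exists_transportCode_reverseCode i
  obtain ⟨φ, rfl⟩ := mem_permCodes.1 hP
  refine equivAutK5_iff.2 ⟨φ, rotCode_injective ?_⟩
  rw [rotCode_transport, rotCode_inv]
  exact h

theorem equivFullK5_repSys_iff {i : Fin 45} {ρ : K5RotSys} : EquivFullK5 (repSys i) ρ ↔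
    EquivAutK5 (repSys i) ρ ∨ EquivAutK5 (repSys (mirrorIndex i)) ρ := by
  rw [equivFullK5_iff]
  exact or_congr_right ⟨(equivAutK5_inv_repSys i).symm.trans, (equivAutK5_inv_repSys i).trans⟩

theorem existsUnique_equivFullK5_repSys {ρ : K5RotSys} (hρ : IsRotSysK5 ρ) (hf : HasFaces ρ 3) :
    ∃! i : Fin 31, EquivFullK5 (repSys (i.castLE (by norm_num))) ρ := by
  obtain ⟨j, hj, huniq⟩ := existsUnique_equivAutK5_repSys hρ hf
  have h : ∀ i, EquivFullK5 (repSys i) ρ ↔ i = j ∨ mirrorIndex i = j := fun i => by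
    rw [equivFullK5_repSys_iff]
    exact or_congr ⟨huniq _, fun h => h ▸ hj⟩ ⟨huniq _, fun h => h ▸ hj⟩
  simp only [h]
  clear h huniq hj
  revert j
  unfold ExistsUnique
  decide +kernel

/-- Rotation systems of `K₅` with exactly 3 faces (2-cell embeddings of `K₅` on
the double torus) fall into exactly 31 orbits under `Aut(K₅) × C₂`, and into
exactly 45 orbits under `Aut(K₅)` alone. -/
theorem K5_double_torus_embeddings :
    (∃ reps : Fin 31 → K5RotSys,
      (∀ i, IsRotSysK5 (reps i) ∧ HasFaces (reps i) 3) ∧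
      ∀ ρ, IsRotSysK5 ρ → HasFaces ρ 3 → ∃! i, EquivFullK5 (reps i) ρ) ∧
    (∃ reps : Fin 45 → K5RotSys,
      (∀ i, IsRotSysK5 (reps i) ∧ HasFaces (reps i) 3) ∧
      ∀ ρ, IsRotSysK5 ρ → HasFaces ρ 3 → ∃! i, EquivAutK5 (reps i) ρ) :=
  ⟨⟨fun i => repSys (i.castLE (by norm_num)),
      fun i => ⟨isRotSysK5_repSys _, hasFaces_repSys _⟩,
      fun _ => existsUnique_equivFullK5_repSys⟩,
    ⟨repSys, fun i => ⟨isRotSysK5_repSys i, hasFaces_repSys i⟩,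
      fun _ => existsUnique_equivAutK5_repSys⟩⟩
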